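/- arXiv:2010.00671 — 2 statements merged into one kernel-verified Lean document; each statement's English description precedes it below -/
import Mathlib

section
/- As x → 0 from the right, ψ(x)/x² tends to 3; equivalently, φ_0(x) ∼ (3/μ)·x² as x → 0+. -/
/-- `a n = (4/n^4)·tanh(nπ/2) − π/n^3`. -/
noncomputable def a (n : ℕ) : ℝ :=
  4 / (n : ℝ) ^ 4 * Real.tanh ((n : ℝ) * Real.pi / 2) - Real.pi / (n : ℝ) ^ 3

/-- `ψ(z) = (24/π^4) · Σ_{n odd} a_n · sin(nπz)`, the sum over odd positive integers. -/
noncomputable def psi (z : ℝ) : ℝ :=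
  (24 / Real.pi ^ 4) * ∑' k : ℕ, a (2 * k + 1) * Real.sin ((2 * (k : ℝ) + 1) * Real.pi * z)

/-- `μ = (48/π^4) Σ_{n odd} sech²(nπ/2)/n^4`. -/
noncomputable def mu : ℝ :=
  (48 / Real.pi ^ 4) *
    ∑' k : ℕ, (1 / Real.cosh ((2 * (k : ℝ) + 1) * Real.pi / 2)) ^ 2 / (2 * (k : ℝ) + 1) ^ 4

/-- The splitting density `φ_0 = ψ/μ`. -/
noncomputable def phi0 (z : ℝ) : ℝ := psi z / mu

lemma aux_odd {f : ℕ → ℝ} {A B : ℝ} (h : HasSum f A) (h2 : HasSum (fun k => f (2 * k)) B) :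
    HasSum (fun k => f (2 * k + 1)) (A - B) := by
  have hs : Summable (fun k : ℕ => f (2 * k + 1)) :=
    h.summable.comp_injective (i := fun k : ℕ => 2 * k + 1) (fun a b hab => by
      have : 2 * a + 1 = 2 * b + 1 := hab
      omega)
  have h3 := (h2.even_add_odd hs.hasSum).unique h
  have : A - B = ∑' k : ℕ, f (2 * k + 1) := by linarith
  rw [this]
  exact hs.hasSum

lemma aux_coth {x : ℝ} (hx : 0 < x) :
    HasSum (fun m : ℕ => 2 * x / (x ^ 2 + (m : ℝ) ^ 2))
      (Real.pi * (Real.cosh (Real.pi * x) / Real.sinh (Real.pi * x)) + 1 / x) := by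
  have hz : (x : ℂ) * Complex.I ∈ Complex.integerComplement := by
    rintro ⟨n, hn⟩
    have := congrArg Complex.im hn
    simp at this
    exact hx.ne this
  have h1 := cot_series_rep' hz
  have hs := (summable_cotTerm hz).hasSum
  have hs' : HasSum (fun n : ℕ => 1 / ((x : ℂ) * Complex.I - (n + 1)) + 1 / ((x : ℂ) * Complex.I + (n + 1)))
      (Real.pi * Complex.cot (Real.pi * ((x : ℂ) * Complex.I)) - 1 / ((x : ℂ) * Complex.I)) := by
    rw [h1]; exact hs
  have hsinh : Real.sinh (Real.pi * x) ≠ 0 := by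
    rw [Real.sinh_ne_zero]; positivity
  have h4 : HasSum (fun n : ℕ => 2 * x / (x ^ 2 + ((n + 1 : ℕ) : ℝ) ^ 2))
      (Real.pi * (Real.cosh (Real.pi * x) / Real.sinh (Real.pi * x)) - 1 / x) := by
    rw [← Complex.hasSum_ofReal]
    have h5 := hs'.mul_left Complex.I
    have hxc : (x : ℂ) ≠ 0 := by exact_mod_cast hx.ne'
    have hsc : Complex.sinh (Real.pi * x) ≠ 0 := by exact_mod_cast hsinh
    have hI := Complex.I_sq
    convert! h5 using 1
    · funext n
      have e1 : (x : ℂ) * Complex.I - (n + 1) ≠ 0 := by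
        intro h
        have := congrArg Complex.im h
        simp at this
        exact hx.ne' this
      have e2 : (x : ℂ) * Complex.I + (n + 1) ≠ 0 := by
        intro h
        have := congrArg Complex.im h
        simp at this
        exact hx.ne' this
      have e3 : (x : ℂ) ^ 2 + (n + 1) ^ 2 ≠ 0 := by
        have : x ^ 2 + ((n : ℝ) + 1) ^ 2 ≠ 0 := by positivity
        exact_mod_cast this
      push_cast
      field_simp
      ring_nf
      simp only [hI]
      try ring
    · rw [show (Real.pi : ℂ) * (x * Complex.I) = (Real.pi * x) * Complex.I by ring, Complex.cot,
        Complex.cos_mul_I, Complex.sin_mul_I]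
      push_cast
      field_simp
  rw [← hasSum_nat_add_iff' 1]
  convert! h4 using 1
  simp
  field_simp
  ring

lemma aux_tanh {x : ℝ} (hx : 0 < x) :
    HasSum (fun k : ℕ => 1 / (x ^ 2 + (2 * (k : ℝ) + 1) ^ 2))
      (Real.pi * Real.tanh (x * Real.pi / 2) / (4 * x)) := by
  have h1 := aux_coth hx
  have h2 := (aux_coth (half_pos hx)).mul_left (1/2)
  have h3 := (aux_odd h1 (B := (1/2) * (Real.pi * (Real.cosh (Real.pi * (x/2)) / Real.sinh (Real.pi * (x/2))) + 1 / (x/2))) (by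
    convert! h2 using 1
    funext k
    push_cast
    have : x ^ 2 + (2 * (k : ℝ)) ^ 2 ≠ 0 := by positivity
    have : (x/2) ^ 2 + (k : ℝ) ^ 2 ≠ 0 := by positivity
    field_simp
    try ring)).mul_left (1 / (2 * x))
  convert! h3 using 1
  · funext k
    push_cast
    field_simp
  · have e : Real.pi * x = 2 * (x * Real.pi / 2) := by ring
    have e' : Real.pi * (x / 2) = x * Real.pi / 2 := by ring
    rw [e, e', Real.tanh_eq_sinh_div_cosh, Real.cosh_two_mul, Real.sinh_two_mul]
    have hs : Real.sinh (x * Real.pi / 2) ≠ 0 := by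
      rw [Real.sinh_ne_zero]; positivity
    have hc : Real.cosh (x * Real.pi / 2) ≠ 0 := (Real.cosh_pos _).ne'
    field_simp
    ring

lemma aux_two : HasSum (fun k : ℕ => 1 / (2 * (k : ℝ) + 1) ^ 2) (Real.pi ^ 2 / 8) := by
  have h := aux_odd hasSum_zeta_two (B := (1/4) * (Real.pi ^ 2 / 6)) (by
    convert! hasSum_zeta_two.mul_left (1/4) using 1
    funext k
    push_cast
    rw [mul_pow, ← div_div, div_mul_div_comm]
    norm_num
    ring)
  convert! h using 1
  · funext k; push_cast; rfl
  · ring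

noncomputable def auxF (p : ℕ × ℕ) : ℝ :=
  1 / ((2 * (p.1 : ℝ) + 1) ^ 2 * ((2 * (p.1 : ℝ) + 1) ^ 2 + (2 * (p.2 : ℝ) + 1) ^ 2))

noncomputable def auxG (p : ℕ × ℕ) : ℝ :=
  (1 / (2 * (p.1 : ℝ) + 1) ^ 2) * (1 / (2 * (p.2 : ℝ) + 1) ^ 2)

lemma aux_F : HasSum auxF (Real.pi ^ 4 / 128) := by
  have hnn : (0 : ℕ → ℝ) ≤ fun k : ℕ => 1 / (2 * (k : ℝ) + 1) ^ 2 := fun k => by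
    show (0 : ℝ) ≤ 1 / (2 * (k : ℝ) + 1) ^ 2
    positivity
  have hGs0 := aux_two.summable.mul_of_nonneg aux_two.summable hnn hnn
  have hG0 := aux_two.mul aux_two hGs0
  have hGs : Summable auxG := hGs0
  have hG : HasSum auxG (Real.pi ^ 2 / 8 * (Real.pi ^ 2 / 8)) := hG0
  have hFs : Summable auxF := by
    refine Summable.of_nonneg_of_le (fun _ => by unfold auxF; positivity) (fun p => ?_) hGs
    simp only [auxF, auxG]
    rw [div_mul_div_comm, one_mul]
    gcongr
    nlinarith [sq_nonneg (2 * (p.1 : ℝ) + 1)]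
  have hF := hFs.hasSum
  have hF' : HasSum (auxF ∘ (Equiv.prodComm ℕ ℕ)) (∑' p, auxF p) :=
    (Equiv.hasSum_iff (Equiv.prodComm ℕ ℕ)).2 hF
  have hsum := hF.add hF'
  have : (fun p => auxF p + (auxF ∘ (Equiv.prodComm ℕ ℕ)) p) = auxG := by
    funext p
    simp only [auxF, auxG, Function.comp, Equiv.prodComm_apply, Prod.fst_swap, Prod.snd_swap]
    field_simp
    ring
  rw [this] at hsum
  have hval := hsum.unique hG
  have : ∑' p, auxF p = Real.pi ^ 4 / 128 := by linarith
  rwa [this] at hF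

lemma aux_dbl : HasSum (fun k : ℕ => Real.tanh ((2 * (k : ℝ) + 1) * Real.pi / 2) / (2 * (k : ℝ) + 1) ^ 3)
    (Real.pi ^ 3 / 32) := by
  have hF2 := aux_F
  have hfib := hF2.prod_fiberwise (g := fun k : ℕ =>
    1 / (2 * (k : ℝ) + 1) ^ 2 * (Real.pi * Real.tanh ((2 * (k : ℝ) + 1) * Real.pi / 2) / (4 * (2 * (k : ℝ) + 1))))
    (fun k => by
      convert! (aux_tanh (x := 2 * (k : ℝ) + 1) (by positivity)).mul_left (1 / (2 * (k : ℝ) + 1) ^ 2) using 1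
      funext m
      simp only [auxF]
      rw [div_mul_div_comm, one_mul])
  convert! hfib.mul_left (4 / Real.pi) using 1
  · funext k
    field_simp
  · field_simp
    norm_num

lemma aux_sin {z : ℝ} (h0 : 0 ≤ z) (h1 : z ≤ 1) :
    HasSum (fun k : ℕ => Real.sin ((2 * (k : ℝ) + 1) * Real.pi * z) / (2 * (k : ℝ) + 1) ^ 3)
      (Real.pi ^ 3 / 8 * (z - z ^ 2)) := by
  have hB : ∀ x ∈ Set.Icc (0 : ℝ) 1, HasSum (fun n : ℕ => 1 / (n : ℝ) ^ 3 * Real.sin (2 * Real.pi * n * x))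
      ((2 * Real.pi) ^ 3 / 12 * (x ^ 3 - 3 / 2 * x ^ 2 + x / 2)) := by
    intro x hx
    have h := hasSum_one_div_nat_pow_mul_sin one_ne_zero hx
    convert! h using 1
    have : (Polynomial.map (algebraMap ℚ ℝ) (Polynomial.bernoulli (2 * 1 + 1))).eval x
        = x ^ 3 - 3 / 2 * x ^ 2 + x / 2 := by
      have h3 : bernoulli 3 = 0 := by
        rw [bernoulli_eq_bernoulli'_of_ne_one (by decide : 3 ≠ 1), bernoulli'_three]
      simp [Polynomial.bernoulli_def, Finset.sum_range_succ, h3]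
      ring
    rw [this]
    simp [Nat.factorial]
    left
    ring
  have hA := hB (z / 2) ⟨by linarith, by linarith⟩
  have hC := (hB z ⟨h0, h1⟩).mul_left (1 / 8)
  have h := aux_odd hA (B := 1 / 8 * ((2 * Real.pi) ^ 3 / 12 * (z ^ 3 - 3 / 2 * z ^ 2 + z / 2))) (by
    convert! hC using 1
    funext k
    push_cast
    rw [show 2 * Real.pi * (2 * (k : ℝ)) * (z / 2) = 2 * Real.pi * k * z by ring, mul_pow,
      ← mul_assoc, div_mul_div_comm]
    norm_num)
  convert! h using 1
  · funext k
    push_cast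
    rw [show 2 * Real.pi * (2 * (k : ℝ) + 1) * (z / 2) = (2 * (k : ℝ) + 1) * Real.pi * z by ring]
    ring
  · ring

lemma aux_tanh_abs (x : ℝ) : |Real.tanh x| ≤ 1 :=
  abs_le.2 ⟨(Real.neg_one_lt_tanh x).le, (Real.tanh_lt_one x).le⟩

lemma aux_sin_bd (t : ℝ) : |Real.sin t - t| ≤ 2 * t ^ 2 := by
  rw [abs_sub_comm]
  rcases le_total |t| 1 with h | h
  · have := Real.abs_sub_sin_le t
    have h2 := sq_abs t
    nlinarith [abs_nonneg t, mul_nonneg (sq_nonneg |t|) (sub_nonneg.2 h)]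
  · have h1 : |t - Real.sin t| ≤ |t| + |Real.sin t| := abs_sub _ _
    have h3 := Real.abs_sin_le_one t
    have h2 := sq_abs t
    nlinarith

lemma aux_lim : Filter.Tendsto (fun x : ℝ => ∑' k : ℕ,
      Real.tanh ((2 * (k : ℝ) + 1) * Real.pi / 2) / (2 * (k : ℝ) + 1) ^ 4 *
        ((Real.sin ((2 * (k : ℝ) + 1) * Real.pi * x) - (2 * (k : ℝ) + 1) * Real.pi * x) / x ^ 2))
    (nhdsWithin 0 (Set.Ioi 0)) (nhds 0) := by
  have key := tendsto_tsum_of_dominated_convergence (𝓕 := nhdsWithin (0 : ℝ) (Set.Ioi 0))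
    (f := fun (x : ℝ) (k : ℕ) =>
      Real.tanh ((2 * (k : ℝ) + 1) * Real.pi / 2) / (2 * (k : ℝ) + 1) ^ 4 *
        ((Real.sin ((2 * (k : ℝ) + 1) * Real.pi * x) - (2 * (k : ℝ) + 1) * Real.pi * x) / x ^ 2))
    (g := fun _ => 0) (bound := fun k : ℕ => 2 * Real.pi ^ 2 * (1 / (2 * (k : ℝ) + 1) ^ 2))
    (aux_two.summable.mul_left _) ?_ ?_
  · simpa using key
  · intro k
    rw [show (0 : ℝ) = Real.tanh ((2 * (k : ℝ) + 1) * Real.pi / 2) / (2 * (k : ℝ) + 1) ^ 4 * 0 by ring]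
    refine Filter.Tendsto.const_mul _ ?_
    set c : ℝ := (2 * (k : ℝ) + 1) * Real.pi with hc
    have hc0 : 0 < c := by positivity
    have hlim : Filter.Tendsto (fun x : ℝ => c ^ 3 / 6 * x) (nhdsWithin 0 (Set.Ioi 0)) (nhds 0) := by
      have : Filter.Tendsto (fun x : ℝ => c ^ 3 / 6 * x) (nhds 0) (nhds (c ^ 3 / 6 * 0)) :=
        (continuous_const.mul continuous_id).tendsto 0
      rw [mul_zero] at this
      exact this.mono_left nhdsWithin_le_nhds
    simp only [mul_zero]
    refine squeeze_zero_norm' ?_ hlim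
    filter_upwards [self_mem_nhdsWithin] with x hx
    have hx : 0 < x := hx
    rw [Real.norm_eq_abs, abs_div, abs_of_pos (pow_pos hx 2), div_le_iff₀ (pow_pos hx 2), abs_sub_comm]
    refine (Real.abs_sub_sin_le _).trans (le_of_eq ?_)
    rw [abs_of_pos (mul_pos hc0 hx)]
    ring
  · filter_upwards [self_mem_nhdsWithin] with x hx k
    have hx : 0 < x := hx
    have hb := aux_sin_bd ((2 * (k : ℝ) + 1) * Real.pi * x)
    have ht := aux_tanh_abs ((2 * (k : ℝ) + 1) * Real.pi / 2)
    have hn : 0 < 2 * (k : ℝ) + 1 := by positivity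
    rw [Real.norm_eq_abs, abs_mul, abs_div, abs_div, abs_of_pos (pow_pos hx 2), abs_of_pos (pow_pos hn 4)]
    calc _ ≤ 1 / (2 * (k : ℝ) + 1) ^ 4 * (2 * ((2 * (k : ℝ) + 1) * Real.pi * x) ^ 2 / x ^ 2) := by
          gcongr
      _ = _ := by field_simp

lemma aux_psi {x : ℝ} (h0 : 0 < x) (h1 : x ≤ 1) :
    psi x / x ^ 2 = 3 + 96 / Real.pi ^ 4 * ∑' k : ℕ,
      Real.tanh ((2 * (k : ℝ) + 1) * Real.pi / 2) / (2 * (k : ℝ) + 1) ^ 4 *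
        ((Real.sin ((2 * (k : ℝ) + 1) * Real.pi * x) - (2 * (k : ℝ) + 1) * Real.pi * x) / x ^ 2) := by
  have hS : Summable (fun k : ℕ => Real.tanh ((2 * (k : ℝ) + 1) * Real.pi / 2) / (2 * (k : ℝ) + 1) ^ 4 *
        ((Real.sin ((2 * (k : ℝ) + 1) * Real.pi * x) - (2 * (k : ℝ) + 1) * Real.pi * x) / x ^ 2)) := by
    refine Summable.of_norm_bounded (g := fun k : ℕ => 2 * Real.pi ^ 2 * (1 / (2 * (k : ℝ) + 1) ^ 2))
      (aux_two.summable.mul_left _) (fun k => ?_)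
    have hb := aux_sin_bd ((2 * (k : ℝ) + 1) * Real.pi * x)
    have ht := aux_tanh_abs ((2 * (k : ℝ) + 1) * Real.pi / 2)
    have hn : 0 < 2 * (k : ℝ) + 1 := by positivity
    rw [Real.norm_eq_abs, abs_mul, abs_div, abs_div, abs_of_pos (pow_pos h0 2), abs_of_pos (pow_pos hn 4)]
    calc _ ≤ 1 / (2 * (k : ℝ) + 1) ^ 4 * (2 * ((2 * (k : ℝ) + 1) * Real.pi * x) ^ 2 / x ^ 2) := by
          gcongr
      _ = _ := by field_simp
  obtain ⟨S, hSS⟩ := hS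
  rw [hSS.tsum_eq]
  have hT := ((hSS.mul_left (4 * x ^ 2)).add (aux_dbl.mul_left (4 * Real.pi * x))).sub
    ((aux_sin h0.le h1).mul_left Real.pi)
  have hE : HasSum (fun k : ℕ => a (2 * k + 1) * Real.sin ((2 * (k : ℝ) + 1) * Real.pi * x))
      (4 * x ^ 2 * S + 4 * Real.pi * x * (Real.pi ^ 3 / 32) -
        Real.pi * (Real.pi ^ 3 / 8 * (x - x ^ 2))) := by
    convert! hT using 1
    funext k
    simp only [a]
    push_cast
    field_simp
    ring
  rw [psi, hE.tsum_eq]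
  field_simp
  ring

/-- As `x → 0+`, `ψ(x)/x² → 3`; equivalently, `φ_0(x) ∼ (3/μ)x²` as `x → 0+`. -/
theorem psi_near_zero :
    Filter.Tendsto (fun x : ℝ => psi x / x ^ 2) (nhdsWithin 0 (Set.Ioi 0)) (nhds 3)
    ∧ Filter.Tendsto (fun x : ℝ => phi0 x / x ^ 2) (nhdsWithin 0 (Set.Ioi 0))
        (nhds (3 / mu)) := by
  have h : Filter.Tendsto (fun x : ℝ => psi x / x ^ 2) (nhdsWithin 0 (Set.Ioi 0)) (nhds 3) := by
    have h2 := (aux_lim.const_mul (96 / Real.pi ^ 4)).const_add 3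
    rw [mul_zero, add_zero] at h2
    refine h2.congr' ?_
    filter_upwards [Ioc_mem_nhdsGT (zero_lt_one (α := ℝ))] with x hx
    exact (aux_psi hx.1 hx.2).symm
  refine ⟨h, ?_⟩
  have h3 := h.div_const mu
  refine h3.congr (fun x => ?_)
  rw [phi0, div_right_comm]
end

section
/- The identity 1 − (16/π^3) · Σ_{n odd} coth(nπ/2)/n^3 = (32/π^3) · Σ_{n odd} (−1)^{(n−1)/2} · sech(nπ/2)/n^3 holds, where both sums run over odd positive integers n. -/
open Filter Asymptotics

lemma HasSum.congr_hs {ι α : Type*} [AddCommMonoid α] [TopologicalSpace α] {f g : ι → α} {a : α}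
    (h : HasSum f a) (e : ∀ i, g i = f i) : HasSum g a := by
  rwa [show g = f from funext e]

lemma HasSum.conv_hs {ι α : Type*} [AddCommMonoid α] [TopologicalSpace α] {f g : ι → α} {a b : α}
    (h : HasSum f a) (e : ∀ i, g i = f i) (hb : b = a) : HasSum g b := by
  rw [hb]
  exact h.congr_hs e

lemma cot_diff_hasSum {w v : ℂ} (hw : w ∈ Complex.integerComplement)
    (hv : v ∈ Complex.integerComplement) :
    HasSum (fun j : ℤ => 1 / (w + j) - 1 / (v + j))
      (Real.pi * Complex.cot (Real.pi * w) - Real.pi * Complex.cot (Real.pi * v)) := by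
  have hne : ∀ {x : ℂ}, x ∈ Complex.integerComplement → ∀ j : ℤ, x + j ≠ 0 :=
    fun hx j => Complex.integerComplement_add_ne_zero hx j
  have hs : Summable (fun j : ℤ => 1 / (w + j) - 1 / (v + j)) := by
    have h : Summable fun n : ℤ ↦ ((w + n) * (v + n))⁻¹ := by
      apply EisensteinSeries.summable_inv_of_isBigO_rpow_inv (a := 2) (by norm_num)
      have h1 := EisensteinSeries.linear_inv_isBigO_right 1 w
      have h2 := EisensteinSeries.linear_inv_isBigO_right 1 v
      simpa [pow_two, mul_comm] using h1.mul h2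
    refine (h.mul_left (v - w)).congr fun j => ?_
    have := hne hw j
    have := hne hv j
    field_simp
    ring
  have h1 := (hs.hasSum.nat_add_neg)
  rw [← hasSum_nat_add_iff' 1] at h1
  have cw := (summable_cotTerm hw).hasSum
  have cv := (summable_cotTerm hv).hasSum
  have e : ∀ {x : ℂ}, x ∈ Complex.integerComplement → ∑' n, cotTerm x n =
      Real.pi * Complex.cot (Real.pi * x) - 1 / x := fun hx => (cot_series_rep' hx).symm
  rw [e hw] at cw
  rw [e hv] at cv
  have h2 := h1.unique ((cw.sub cv).congr_hs (fun n => by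
    simp only [cotTerm]; push_cast; ring))
  have : ∑' j : ℤ, (1 / (w + j) - 1 / (v + j)) =
      (Real.pi * Complex.cot (Real.pi * w) - Real.pi * Complex.cot (Real.pi * v)) := by
    simp at h2
    simp
    linear_combination h2
  rw [← this]
  exact hs.hasSum

lemma int_compl_of_im {z : ℂ} (h : z.im ≠ 0) : z ∈ Complex.integerComplement := by
  rintro ⟨n, rfl⟩
  simp at h

lemma odd_ne (p : ℤ) : (2 * (p : ℝ) + 1) ≠ 0 := by
  have : 2 * p + 1 ≠ 0 := by omega
  exact_mod_cast this

lemma four_ne (p : ℤ) : (4 * (p : ℝ) + 1) ≠ 0 := by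
  have : 4 * p + 1 ≠ 0 := by omega
  exact_mod_cast this

lemma sech_hasSum {x : ℝ} (hx : x ≠ 0) :
    HasSum (fun j : ℤ => 1 / ((4 * (j : ℝ) + 1) * ((4 * (j : ℝ) + 1) ^ 2 + x ^ 2)))
      (Real.pi / (4 * x ^ 2) * (1 - 1 / Real.cosh (x * Real.pi / 2))) := by
  rw [← Complex.hasSum_ofReal]
  have hw : (1 / 4 : ℂ) ∈ Complex.integerComplement := by
    rintro ⟨n, hn⟩
    have : (4 * n : ℂ) = 1 := by rw [hn]; norm_num
    have : 4 * n = 1 := by exact_mod_cast this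
    omega
  have h1 : ((1 + Complex.I * x) / 4 : ℂ) ∈ Complex.integerComplement := int_compl_of_im (by simpa using hx)
  have h2 : ((1 - Complex.I * x) / 4 : ℂ) ∈ Complex.integerComplement := int_compl_of_im (by simpa using hx)
  have H := ((cot_diff_hasSum hw h1).add (cot_diff_hasSum hw h2)).mul_left (1 / (8 * (x : ℂ) ^ 2))
  have hxc : (x : ℂ) ≠ 0 := by exact_mod_cast hx
  refine H.conv_hs (fun j => ?_) ?_
  · have a0 := Complex.integerComplement_add_ne_zero hw j
    have a1 := Complex.integerComplement_add_ne_zero h1 j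
    have a2 := Complex.integerComplement_add_ne_zero h2 j
    have b0 : (1 + 4 * j : ℂ) ≠ 0 := fun h => a0 (by linear_combination h / 4)
    have b1 : (1 + Complex.I * x + 4 * j : ℂ) ≠ 0 := fun h => a1 (by linear_combination h / 4)
    have b2 : (1 - Complex.I * x + 4 * j : ℂ) ≠ 0 := fun h => a2 (by linear_combination h / 4)
    have e0 : (1 / 4 + j : ℂ) = (1 + 4 * j) / 4 := by ring
    have e1 : ((1 + Complex.I * x) / 4 + j : ℂ) = (1 + Complex.I * x + 4 * j) / 4 := by ring
    have e2 : ((1 - Complex.I * x) / 4 + j : ℂ) = (1 - Complex.I * x + 4 * j) / 4 := by ring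
    rw [e0, e1, e2]
    push_cast
    have e3 : ((4 * j + 1 : ℂ) ^ 2 + x ^ 2) = (1 + Complex.I * x + 4 * j) * (1 - Complex.I * x + 4 * j) := by
      ring_nf; rw [Complex.I_sq]; ring
    rw [e3, show (4 * j + 1 : ℂ) = 1 + 4 * j by ring]
    field_simp
    ring_nf
    rw [Complex.I_sq]; ring
  · have c0 : Complex.cot (Real.pi * (1 / 4)) = 1 := by
      have : (Real.pi * (1 / 4) : ℂ) = ((Real.pi / 4 : ℝ) : ℂ) := by push_cast; ring
      rw [this, Complex.cot, ← Complex.ofReal_cos, ← Complex.ofReal_sin, Real.cos_pi_div_four, Real.sin_pi_div_four]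
      exact div_self (by simp)
    have s1 := sin_pi_mul_ne_zero h1
    have s2 := sin_pi_mul_ne_zero h2
    have hc : ((Real.cosh (x * Real.pi / 2) : ℝ) : ℂ) ≠ 0 := by
      exact_mod_cast (Real.cosh_pos _).ne'
    have key : Complex.cot (Real.pi * ((1 + Complex.I * x) / 4)) + Complex.cot (Real.pi * ((1 - Complex.I * x) / 4))
        = 2 / ((Real.cosh (x * Real.pi / 2) : ℝ) : ℂ) := by
      rw [Complex.cot, Complex.cot, div_add_div _ _ s1 s2, div_eq_div_iff (mul_ne_zero s1 s2) hc]
      set A := (Real.pi * ((1 + Complex.I * x) / 4) : ℂ) with hA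
      set B := (Real.pi * ((1 - Complex.I * x) / 4) : ℂ) with hB
      have t1 : Complex.sin (A + B) = 1 := by
        rw [show A + B = ((Real.pi / 2 : ℝ) : ℂ) by rw [hA, hB]; push_cast; ring, ← Complex.ofReal_sin]; simp
      have t2 : Complex.cos (A + B) = 0 := by
        rw [show A + B = ((Real.pi / 2 : ℝ) : ℂ) by rw [hA, hB]; push_cast; ring, ← Complex.ofReal_cos]; simp
      have t3 : Complex.cos (A - B) = ((Real.cosh (x * Real.pi / 2) : ℝ) : ℂ) := by
        rw [show A - B = ((x * Real.pi / 2 : ℝ) : ℂ) * Complex.I by rw [hA, hB]; push_cast; ring, Complex.cos_mul_I]; simp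
      rw [Complex.sin_add] at t1
      rw [Complex.cos_add] at t2
      rw [Complex.cos_sub] at t3
      rw [← t3]
      linear_combination (Complex.cos A * Complex.cos B + Complex.sin A * Complex.sin B) * t1 + t2
    rw [c0]
    have : Complex.cot (Real.pi * ((1 + Complex.I * x) / 4)) = 2 / ((Real.cosh (x * Real.pi / 2) : ℝ) : ℂ) - Complex.cot (Real.pi * ((1 - Complex.I * x) / 4)) := by
      linear_combination key
    rw [this]
    push_cast at hc ⊢
    field_simp
    ring

lemma pf_aux {c j : ℂ} (h1 : c + 2 * j ≠ 0) (h2 : -c + 2 * j ≠ 0) :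
    1 / (c / 2 + j) - 1 / (-c / 2 + j) = - 4 * c / ((c + 2 * j) * (-c + 2 * j)) := by
  rw [show (c / 2 + j : ℂ) = (c + 2 * j) / 2 by ring, show (-c / 2 + j : ℂ) = (-c + 2 * j) / 2 by ring]
  field_simp
  ring

lemma coth_hasSum (p : ℤ) :
    HasSum (fun q : ℤ => 1 / ((2 * (p : ℝ) + 1) ^ 4 - (2 * (q : ℝ)) ^ 4))
      (Real.pi / 4 * ((Real.cosh ((2 * (p : ℝ) + 1) * Real.pi / 2) /
        Real.sinh ((2 * (p : ℝ) + 1) * Real.pi / 2)) / (2 * (p : ℝ) + 1) ^ 3)) := by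
  have ha := odd_ne p
  obtain ⟨a, hdef⟩ : ∃ a : ℝ, a = 2 * (p : ℝ) + 1 := ⟨_, rfl⟩
  rw [← hdef] at ha ⊢
  rw [← Complex.hasSum_ofReal]
  have hac : (a : ℂ) ≠ 0 := by exact_mod_cast ha
  have hint : ∀ s : ℤ, s % 2 = 1 → (s * a / 2 : ℂ) ∈ Complex.integerComplement := by
    rintro s hs ⟨n, hn⟩
    have : (2 * n : ℂ) = s * (2 * p + 1) := by rw [hn, hdef]; push_cast; ring
    have : 2 * n = s * (2 * p + 1) := by exact_mod_cast this
    have := congrArg (· % 2) this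
    simp [Int.mul_emod, Int.add_emod, hs] at this
  have w1 : (a / 2 : ℂ) ∈ Complex.integerComplement := by simpa using hint 1 rfl
  have w2 : (-a / 2 : ℂ) ∈ Complex.integerComplement := by simpa using hint (-1) rfl
  have w3 : (Complex.I * a / 2 : ℂ) ∈ Complex.integerComplement := int_compl_of_im (by simpa using ha)
  have w4 : (-Complex.I * a / 2 : ℂ) ∈ Complex.integerComplement := int_compl_of_im (by simpa using ha)
  have H := (((cot_diff_hasSum w1 w2).mul_left (1 / (8 * (a : ℂ) ^ 3)))).add
    ((cot_diff_hasSum w4 w3).mul_left (1 / (8 * Complex.I * (a : ℂ) ^ 3)))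
  have hI := Complex.I_ne_zero
  refine H.conv_hs (fun j => ?_) ?_
  · have a1 := Complex.integerComplement_add_ne_zero w1 j
    have a2 := Complex.integerComplement_add_ne_zero w2 j
    have a3 := Complex.integerComplement_add_ne_zero w3 j
    have a4 := Complex.integerComplement_add_ne_zero w4 j
    have b1 : (a + 2 * j : ℂ) ≠ 0 := fun h => a1 (by linear_combination h / 2)
    have b2 : (-a + 2 * j : ℂ) ≠ 0 := fun h => a2 (by linear_combination h / 2)
    have b3 : (Complex.I * a + 2 * j : ℂ) ≠ 0 := fun h => a3 (by linear_combination h / 2)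
    have b4 : (-Complex.I * a + 2 * j : ℂ) ≠ 0 := fun h => a4 (by linear_combination h / 2)
    have p1 := pf_aux b1 b2
    have p2 : 1 / (-Complex.I * a / 2 + j : ℂ) - 1 / (Complex.I * a / 2 + j : ℂ) = 4 * Complex.I * a / ((Complex.I * a + 2 * j) * (-Complex.I * a + 2 * j)) := by
      have := pf_aux b3 (by simpa using b4)
      rw [neg_mul, ← neg_sub, this]
      ring
    have q1 : ((Complex.I * a + 2 * j) * (-Complex.I * a + 2 * j) : ℂ) = a ^ 2 + 4 * j ^ 2 := by
      ring_nf; rw [Complex.I_sq]; ring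
    have q2 : (a ^ 2 + 4 * j ^ 2 : ℂ) ≠ 0 := q1 ▸ mul_ne_zero b3 b4
    rw [p1, p2, q1]
    push_cast
    rw [show (a ^ 4 - (2 * j) ^ 4 : ℂ) = -((a + 2 * j) * (-a + 2 * j) * (a ^ 2 + 4 * j ^ 2)) by ring]
    have key : (a + 2 * j : ℂ) * (-a + 2 * j) - (a ^ 2 + 4 * j ^ 2) = -2 * a ^ 2 := by ring
    generalize (a + 2 * j : ℂ) = X at *
    generalize (-a + 2 * j : ℂ) = Y at *
    generalize (a ^ 2 + 4 * j ^ 2 : ℂ) = Q at *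
    field_simp
    linear_combination (-4) * key
  · have c1 : Complex.cos (Real.pi * (a / 2)) = 0 := by
      rw [Complex.cos_eq_zero_iff]
      exact ⟨p, by rw [hdef]; push_cast; ring⟩
    have c2 : Complex.cos (Real.pi * (-a / 2)) = 0 := by
      rw [show (Real.pi * (-a / 2) : ℂ) = -(Real.pi * (a / 2)) by ring, Complex.cos_neg, c1]
    have hs : ((Real.sinh (a * Real.pi / 2) : ℝ) : ℂ) ≠ 0 := by
      have : Real.sinh (a * Real.pi / 2) ≠ 0 := by
        rw [Ne, Real.sinh_eq_zero]
        have := Real.pi_ne_zero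
        positivity
      exact_mod_cast this
    simp only [Complex.cot, c1, c2]
    rw [show (Real.pi * (-Complex.I * a / 2) : ℂ) = -(((a * Real.pi / 2 : ℝ) : ℂ) * Complex.I) by push_cast; ring,
      show (Real.pi * (Complex.I * a / 2) : ℂ) = (((a * Real.pi / 2 : ℝ) : ℂ) * Complex.I) by push_cast; ring,
      Complex.cos_neg, Complex.sin_neg, Complex.cos_mul_I, Complex.sin_mul_I, ← Complex.ofReal_cosh, ← Complex.ofReal_sinh]
    rw [Complex.ofReal_mul, Complex.ofReal_div, Complex.ofReal_div, Complex.ofReal_div, Complex.ofReal_pow]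
    generalize ((Real.sinh (a * Real.pi / 2) : ℝ) : ℂ) = S at *
    field_simp
    rw [Complex.I_sq]
    push_cast
    ring

lemma hasSum_odd_fold {g : ℝ → ℝ} (hg : ∀ x, g (-x) = - g x) {T : ℝ}
    (h : HasSum (fun j : ℤ => g (4 * (j : ℝ) + 1)) T) :
    HasSum (fun k : ℕ => (-1 : ℝ) ^ k * g (2 * (k : ℝ) + 1)) T := by
  have s1 := (h.summable.comp_injective (i := fun n : ℕ => (n : ℤ)) Nat.cast_injective).hasSum
  have s2 := (h.summable.comp_injective (i := fun n : ℕ => (-(n + 1) : ℤ)) (fun a b hab => by simpa using hab)).hasSum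
  have h3 := HasSum.of_nat_of_neg_add_one (f := fun j : ℤ => g (4 * (j : ℝ) + 1)) s1 s2
  rw [h.unique h3]
  apply HasSum.even_add_odd
  · refine s1.conv_hs (fun k => ?_) rfl
    simp only [Function.comp, pow_mul]
    norm_num
    ring_nf
  · refine s2.conv_hs (fun k => ?_) rfl
    simp only [Function.comp, pow_succ, pow_mul]
    norm_num
    rw [← hg]
    ring_nf

lemma hasSum_even_fold {g : ℝ → ℝ} (hg : ∀ x, g (-x) = g x) {T : ℝ}
    (h : HasSum (fun j : ℤ => g (2 * (j : ℝ) + 1)) T) :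
    HasSum (fun k : ℕ => g (2 * (k : ℝ) + 1)) (T / 2) := by
  have s1 := (h.summable.comp_injective (i := fun n : ℕ => (n : ℤ)) Nat.cast_injective).hasSum
  have s2 : HasSum (fun n : ℕ => g (2 * ((-(n + 1) : ℤ) : ℝ) + 1))
      (∑' b : ℕ, ((fun j : ℤ => g (2 * (j : ℝ) + 1)) ∘ fun n : ℕ => (n : ℤ)) b) := by
    refine s1.conv_hs (fun k => ?_) rfl
    simp only [Function.comp]
    rw [← hg]; push_cast; ring_nf
  have h3 := h.unique (HasSum.of_nat_of_neg_add_one (f := fun j : ℤ => g (2 * (j : ℝ) + 1)) s1 s2)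
  exact s1.conv_hs (fun k => by simp) (by linarith)

lemma L3 : HasSum (fun k : ℕ => (-1 : ℝ) ^ k * (1 / (2 * (k : ℝ) + 1) ^ 3)) (Real.pi ^ 3 / 32) := by
  have h := hasSum_L_function_mod_four_eval_three
  have hi : Function.Injective (fun k : ℕ => 2 * k + 1) := fun a b hab => by simpa using hab
  rw [← hi.hasSum_iff] at h
  · refine h.conv_hs (fun k => ?_) rfl
    simp only [Function.comp]
    rw [show Real.pi * ((2 * k + 1 : ℕ) : ℝ) / 2 = Real.pi / 2 + k * Real.pi by push_cast; ring,
      Real.sin_add_nat_mul_pi]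
    simp [mul_comm]
  · intro n hn
    rcases Nat.even_or_odd' n with ⟨k, rfl | rfl⟩
    · rw [show Real.pi * ((2 * k : ℕ) : ℝ) / 2 = k * Real.pi by push_cast; ring, Real.sin_nat_mul_pi]
      simp
    · exact absurd ⟨k, rfl⟩ hn

lemma G_summable : Summable (fun z : ℤ × ℤ => 1 / (4 * (z.1 : ℝ) + 1) *
    (1 / ((4 * (z.2 : ℝ) + 1) * ((4 * (z.2 : ℝ) + 1) ^ 2 + (4 * (z.1 : ℝ) + 1) ^ 2)))) := by
  have h0 : Summable (fun j : ℤ => 1 / (4 * (j : ℝ) + 1) ^ 2) := by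
    have := ((EisensteinSeries.linear_right_summable (1/4) 1 (k := 2) le_rfl).norm).mul_left (1/16)
    refine this.congr fun j => ?_
    have e : ((1 : ℤ) * (1 / 4) + j : ℂ) = (((4 * (j : ℝ) + 1) / 4 : ℝ) : ℂ) := by push_cast; ring
    rw [e]
    rw [norm_inv, norm_zpow, Complex.norm_real]
    rw [show (2 : ℤ) = ((2 : ℕ) : ℤ) from rfl, zpow_natCast, Real.norm_eq_abs, sq_abs]
    have := four_ne j
    field_simp
    norm_num
  have h1 := (h0.mul_of_nonneg h0 (fun j => by positivity) (fun j => by positivity))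
  refine Summable.of_norm_bounded h1 fun z => ?_
  have ha := four_ne z.1
  have hb := four_ne z.2
  generalize (4 * (z.1 : ℝ) + 1) = m at *
  generalize (4 * (z.2 : ℝ) + 1) = n at *
  simp only [norm_mul, norm_div, norm_one, Real.norm_eq_abs]
  rw [abs_of_nonneg (by positivity : 0 ≤ n ^ 2 + m ^ 2), ← sq_abs m, ← sq_abs n]
  have hm := abs_pos.2 ha
  have hn := abs_pos.2 hb
  generalize |m| = m at *
  generalize |n| = n at *
  rw [div_mul_div_comm, div_mul_div_comm, one_mul]
  apply one_div_le_one_div_of_le (by positivity)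
  have := mul_pos hm hn
  nlinarith [sq_nonneg (m - n), mul_pos hm hn, mul_nonneg this.le (sq_nonneg (m - n)), mul_pos this this]

lemma F_hasSum {T : ℝ} (h : HasSum (fun z : ℤ × ℤ => 1 / (4 * (z.1 : ℝ) + 1) *
    (1 / ((4 * (z.2 : ℝ) + 1) * ((4 * (z.2 : ℝ) + 1) ^ 2 + (4 * (z.1 : ℝ) + 1) ^ 2)))) T) :
    HasSum (fun z : ℤ × ℤ => 1 / ((2 * (z.1 : ℝ) + 1) ^ 4 - (2 * (z.2 : ℝ)) ^ 4)) (4 * T) := by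
  let f : (ℤ × ℤ) ⊕ (ℤ × ℤ) → ℤ × ℤ := Sum.elim (fun z => (z.1 + z.2, z.1 - z.2))
    (fun z => (-1 - (z.1 + z.2), z.1 - z.2))
  have hf : Function.Bijective f := by
    constructor
    · rintro (⟨a, b⟩ | ⟨a, b⟩) (⟨c, d⟩ | ⟨c, d⟩) hh <;> simp [f] at hh ⊢ <;> omega
    · rintro ⟨p, q⟩
      rcases Int.even_or_odd' (p + q) with ⟨k, hk | hk⟩
      · exact ⟨Sum.inl (k, k - q), by simp [f]; omega⟩
      · exact ⟨Sum.inr (q - k - 1, - k - 1), by simp [f]; omega⟩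
  rw [← (Equiv.ofBijective f hf).hasSum_iff]
  have h2 := h.mul_left 2
  rw [show 4 * T = 2 * T + 2 * T by ring]
  apply HasSum.sum
  all_goals
    refine h2.conv_hs ?_ rfl
    rintro ⟨i, j⟩
    have ha := four_ne i
    have hb := four_ne j
    simp only [Function.comp, Equiv.ofBijective_apply, f, Sum.elim_inl, Sum.elim_inr]
    push_cast
    generalize hm : (4 * (i : ℝ) + 1) = m at *
    generalize hn : (4 * (j : ℝ) + 1) = n at *
    have ei : (i : ℝ) = (m - 1) / 4 := by linarith
    have ej : (j : ℝ) = (n - 1) / 4 := by linarith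
    rw [ei, ej]
    have : 0 < n ^ 2 + m ^ 2 := by positivity
    rw [div_mul_div_comm, ← mul_div_assoc]
    rw [div_eq_div_iff]
    · ring
    · have : m * (n * (n ^ 2 + m ^ 2)) / 2 ≠ 0 := by positivity
      convert this using 1
      ring
    · positivity

/-- `1 − (16/π^3) Σ_{n odd} coth(nπ/2)/n^3 = (32/π^3) Σ_{n odd} (−1)^{(n−1)/2} sech(nπ/2)/n^3`,
sums over odd positive integers (for `n = 2k+1`, `(−1)^{(n−1)/2} = (−1)^k`). -/
theorem coth_sech_identity :
    1 - (16 / Real.pi ^ 3) *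
        ∑' k : ℕ, (Real.cosh ((2 * (k : ℝ) + 1) * Real.pi / 2)
            / Real.sinh ((2 * (k : ℝ) + 1) * Real.pi / 2)) / (2 * (k : ℝ) + 1) ^ 3
      = (32 / Real.pi ^ 3) *
          ∑' k : ℕ, (-1 : ℝ) ^ k *
            (1 / Real.cosh ((2 * (k : ℝ) + 1) * Real.pi / 2)) / (2 * (k : ℝ) + 1) ^ 3 := by
  obtain ⟨T, hG⟩ := G_summable
  have hF := (F_hasSum hG).prod_fiberwise coth_hasSum
  have hC := hasSum_even_fold (g := fun x => Real.pi / 4 * (Real.cosh (x * Real.pi / 2) /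
    Real.sinh (x * Real.pi / 2) / x ^ 3)) (fun x => by
      rw [show -x * Real.pi / 2 = -(x * Real.pi / 2) by ring, Real.cosh_neg, Real.sinh_neg]
      ring) hF
  have hS1 : ∀ i : ℤ, HasSum (fun j : ℤ => 1 / (4 * (i : ℝ) + 1) *
      (1 / ((4 * (j : ℝ) + 1) * ((4 * (j : ℝ) + 1) ^ 2 + (4 * (i : ℝ) + 1) ^ 2))))
      (1 / (4 * (i : ℝ) + 1) * (Real.pi / (4 * (4 * (i : ℝ) + 1) ^ 2) *
        (1 - 1 / Real.cosh ((4 * (i : ℝ) + 1) * Real.pi / 2)))) :=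
    fun i => (sech_hasSum (four_ne i)).mul_left (1 / (4 * (i : ℝ) + 1))
  have hS0 := hG.prod_fiberwise hS1
  have hS := hasSum_odd_fold (g := fun x => 1 / x * (Real.pi / (4 * x ^ 2) *
    (1 - 1 / Real.cosh (x * Real.pi / 2)))) (fun x => by
      rw [show -x * Real.pi / 2 = -(x * Real.pi / 2) by ring, Real.cosh_neg, neg_sq, div_neg]
      ring) hS0
  have hpi := Real.pi_ne_zero
  have eC : ∑' k : ℕ, (Real.cosh ((2 * (k : ℝ) + 1) * Real.pi / 2)
            / Real.sinh ((2 * (k : ℝ) + 1) * Real.pi / 2)) / (2 * (k : ℝ) + 1) ^ 3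
      = 4 / Real.pi * (4 * T / 2) := by
    refine ((hC.mul_left (4 / Real.pi)).congr_hs fun k => ?_).tsum_eq
    generalize Real.cosh _ / Real.sinh _ / _ = c
    field_simp
  have eS : ∑' k : ℕ, (-1 : ℝ) ^ k *
            (1 / Real.cosh ((2 * (k : ℝ) + 1) * Real.pi / 2)) / (2 * (k : ℝ) + 1) ^ 3
      = Real.pi ^ 3 / 32 - 4 / Real.pi * T := by
    refine ((L3.sub (hS.mul_left (4 / Real.pi))).congr_hs fun k => ?_).tsum_eq
    have : (2 * (k : ℝ) + 1) ≠ 0 := by positivity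
    generalize 1 / Real.cosh _ = c
    generalize (2 * (k : ℝ) + 1) = n at *
    field_simp
    ring
  rw [eC, eS]
  field_simp
  ring
end
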